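/- arXiv:1402.4615 — 4 statements merged into one kernel-verified Lean document; each statement's English description precedes it below -/
import Mathlib

section
/- For every integer k ≥ 2 and every real α > 0 there exists a real constant B (depending only on k and α) such that for every Young diagram λ one has |M_k^{(α)}(λ)| ≤ B · (max(λ.rowLen 0, λ.colLen 0))^k, where M_k^{(α)}(λ) = Σ_{c addable} ( Π_{c' removable} (z_c − w_{c'}) / Π_{c' addable, c' ≠ c} (z_c − z_{c'}) ) · z_c^k with z_c = √α · j − i/√α for an addable corner c = (i, j) and w_c = √α · (j + 1) − (i + 1)/√α for a removable corner c = (i, j). Here λ.rowLen 0 is the length of the first row of λ and λ.colLen 0 the length of its first column. -/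
/-- A cell `c ∉ λ` is an addable (inner) corner of `λ` if inserting it yields the
cell set of a Young diagram. -/
def YoungDiagram.IsAddableCorner (lam : YoungDiagram) (c : ℕ × ℕ) : Prop :=
  c ∉ lam ∧ ∃ ν : YoungDiagram, ν.cells = insert c lam.cells

/-- A cell `c ∈ λ` is a removable (outer) corner of `λ` if deleting it yields the
cell set of a Young diagram. -/
def YoungDiagram.IsRemovableCorner (lam : YoungDiagram) (c : ℕ × ℕ) : Prop :=
  c ∈ lam ∧ ∃ ν : YoungDiagram, ν.cells = lam.cells.erase c

/-- The α-content `z_c = √α · j − i/√α` of an addable corner `c = (i, j)`. -/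
noncomputable def innerContent (a : ℝ) (c : ℕ × ℕ) : ℝ :=
  Real.sqrt a * c.2 - c.1 / Real.sqrt a

/-- The α-content `w_c = √α · (j+1) − (i+1)/√α` of a removable corner `c = (i, j)`. -/
noncomputable def outerContent (a : ℝ) (c : ℕ × ℕ) : ℝ :=
  Real.sqrt a * (c.2 + 1) - (c.1 + 1) / Real.sqrt a

/-- The `k`-th moment `M_k^{(α)}(λ)` of the transition measure of the α-anisotropic
diagram `A_α(λ)`, given by the explicit partial-fraction formula. -/
noncomputable def jackMoment (a : ℝ) (lam : YoungDiagram) (k : ℕ) : ℝ :=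
  ∑ᶠ c ∈ {c : ℕ × ℕ | lam.IsAddableCorner c},
    ((∏ᶠ c' ∈ {c' : ℕ × ℕ | lam.IsRemovableCorner c'},
        (innerContent a c - outerContent a c')) /
      ∏ᶠ c' ∈ {c' : ℕ × ℕ | lam.IsAddableCorner c' ∧ c' ≠ c},
        (innerContent a c - innerContent a c'))
      * innerContent a c ^ k

open Finset in
theorem core_sum (Z W : ℕ → ℝ) (S T : Finset ℕ) (hZ : StrictAnti Z) (hc : #T = #S + 1) :
    ∑ i ∈ T, (∏ p ∈ S, (Z i - W p)) / ∏ j ∈ T.erase i, (Z i - Z j) = 1 := by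
  have hm := Polynomial.monic_prod_X_sub_C W S
  have hd : (∏ p ∈ S, (Polynomial.X - Polynomial.C (W p))).degree = (#S : WithBot ℕ) := by
    rw [Polynomial.degree_eq_natDegree hm.ne_zero]; simp
  have h := Lagrange.leadingCoeff_eq_sum (s := T) (v := Z) hZ.injective.injOn
    (P := ∏ p ∈ S, (Polynomial.X - Polynomial.C (W p))) (by rw [hd, hc]; push_cast; rfl)
  rw [hm.leadingCoeff] at h
  rw [h]
  simp [Polynomial.eval_prod]

open Finset in
theorem core_nonneg (Z W : ℕ → ℝ) (S : Finset ℕ) (hZ : StrictAnti Z)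
    (h1 : ∀ p, W p ≤ Z p) (h2 : ∀ p, Z (p + 1) ≤ W p) (i : ℕ)
    (hi : i ∈ insert 0 (S.image Nat.succ)) :
    0 ≤ (∏ p ∈ S, (Z i - W p)) / ∏ j ∈ (insert 0 (S.image Nat.succ)).erase i, (Z i - Z j) := by
  rw [mem_insert, mem_image] at hi
  rcases hi with rfl | ⟨q, hq, rfl⟩
  · apply div_nonneg
    · exact prod_nonneg fun p _ => sub_nonneg.2 ((h1 p).trans (hZ.antitone (Nat.zero_le p)))
    · exact prod_nonneg fun p _ => sub_nonneg.2 (hZ.antitone (Nat.zero_le p))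
  · have he : (insert 0 (S.image Nat.succ)).erase q.succ
        = insert 0 ((S.erase q).image Nat.succ) := by
      ext x
      simp only [mem_erase, mem_insert, mem_image]
      constructor
      · rintro ⟨hx, rfl | ⟨p, hp, rfl⟩⟩
        · exact Or.inl rfl
        · exact Or.inr ⟨p, ⟨fun h => hx (by rw [h]), hp⟩, rfl⟩
      · rintro (rfl | ⟨p, ⟨hpq, hp⟩, rfl⟩)
        · exact ⟨by simp, Or.inl rfl⟩
        · exact ⟨fun h => hpq (Nat.succ_injective h), Or.inr ⟨p, hp, rfl⟩⟩
    rw [he, prod_insert (by simp), prod_image (by intro a _ b _ h; exact Nat.succ_injective h),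
      ← mul_prod_erase S _ hq, mul_div_mul_comm, ← prod_div_distrib]
    apply mul_nonneg
    · exact div_nonneg_of_nonpos (sub_nonpos.2 (h2 q))
        (sub_nonpos.2 (hZ.antitone (Nat.zero_le _)))
    · refine prod_nonneg fun p hp => ?_
      rcases lt_or_gt_of_ne (ne_of_mem_erase hp) with h | h
      · have h3 : Z q.succ ≤ Z p.succ := hZ.antitone (by omega)
        exact div_nonneg_of_nonpos (sub_nonpos.2 (h3.trans (h2 p))) (sub_nonpos.2 h3)
      · have h3 : Z p ≤ Z q.succ := hZ.antitone (by omega)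
        have h4 : Z p.succ ≤ Z q.succ := hZ.antitone (by omega)
        exact div_nonneg (sub_nonneg.2 ((h1 p).trans h3)) (sub_nonneg.2 h4)

/-- rows of removable corners -/
def descRows (lam : YoungDiagram) : Finset ℕ :=
  (Finset.range (lam.colLen 0)).filter fun p => lam.rowLen (p + 1) < lam.rowLen p

theorem mem_descRows (lam : YoungDiagram) (p : ℕ) :
    p ∈ descRows lam ↔ lam.rowLen (p + 1) < lam.rowLen p := by
  unfold descRows
  rw [Finset.mem_filter, Finset.mem_range, and_iff_right_iff_imp]
  intro h
  rw [← YoungDiagram.mem_iff_lt_colLen, YoungDiagram.mem_iff_lt_rowLen]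
  omega

theorem addable_iff (lam : YoungDiagram) (i j : ℕ) :
    lam.IsAddableCorner (i, j) ↔
      j = lam.rowLen i ∧ i ∈ insert 0 ((descRows lam).image Nat.succ) := by
  rw [Finset.mem_insert, Finset.mem_image]
  simp only [mem_descRows]
  constructor
  · rintro ⟨hn, ν, hν⟩
    have hm : ∀ c, c ∈ ν ↔ c = (i, j) ∨ c ∈ lam := fun c => by
      rw [← YoungDiagram.mem_cells, hν, Finset.mem_insert, YoungDiagram.mem_cells]
    have hc : (i, j) ∈ ν := (hm _).2 (Or.inl rfl)
    rw [YoungDiagram.mem_iff_lt_rowLen] at hn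
    constructor
    · rcases j with _ | j
      · omega
      · have := (hm _).1 (ν.up_left_mem le_rfl (Nat.le_succ j) hc)
        rcases this with h | h
        · simp at h
        · rw [YoungDiagram.mem_iff_lt_rowLen] at h; omega
    · rcases i with _ | i
      · exact Or.inl rfl
      · right
        refine ⟨i, ?_, rfl⟩
        have := (hm _).1 (ν.up_left_mem (Nat.le_succ i) le_rfl hc)
        rcases this with h | h
        · simp at h
        · rw [YoungDiagram.mem_iff_lt_rowLen] at h; omega
  · rintro ⟨rfl, hi⟩
    refine ⟨by rw [YoungDiagram.mem_iff_lt_rowLen]; omega,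
      ⟨insert (i, lam.rowLen i) lam.cells, ?_⟩, rfl⟩
    rintro ⟨x, y⟩ ⟨u, v⟩ hle hx
    rw [Prod.mk_le_mk] at hle
    simp only [Finset.coe_insert, Set.mem_insert_iff, Finset.mem_coe, YoungDiagram.mem_cells,
      Prod.mk.injEq] at hx ⊢
    rcases hx with ⟨rfl, rfl⟩ | hx
    · rcases Nat.lt_or_ge u x with hu | hu
      · right
        rcases hi with rfl | ⟨p, hp, rfl⟩
        · omega
        · rw [YoungDiagram.mem_iff_lt_rowLen]
          have := lam.rowLen_anti u p (by omega)
          simp only [Nat.succ_eq_add_one] at hle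
          omega
      · obtain rfl : u = x := by omega
        rw [YoungDiagram.mem_iff_lt_rowLen]
        omega
    · exact Or.inr (lam.up_left_mem hle.1 hle.2 hx)

theorem removable_iff (lam : YoungDiagram) (i j : ℕ) :
    lam.IsRemovableCorner (i, j) ↔ j = lam.rowLen i - 1 ∧ i ∈ descRows lam := by
  simp only [mem_descRows]
  constructor
  · rintro ⟨hn, ν, hν⟩
    have hm : ∀ c, c ∈ ν ↔ c ≠ (i, j) ∧ c ∈ lam := fun c => by
      rw [← YoungDiagram.mem_cells, hν, Finset.mem_erase, YoungDiagram.mem_cells]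
    have hc : (i, j) ∉ ν := fun h => ((hm _).1 h).1 rfl
    have a1 : (i, j + 1) ∉ lam := fun h =>
      hc (ν.up_left_mem le_rfl (Nat.le_succ j) ((hm _).2 ⟨by simp, h⟩))
    have a2 : (i + 1, j) ∉ lam := fun h =>
      hc (ν.up_left_mem (Nat.le_succ i) le_rfl ((hm _).2 ⟨by simp, h⟩))
    rw [YoungDiagram.mem_iff_lt_rowLen] at hn a1 a2
    omega
  · rintro ⟨rfl, hi⟩
    refine ⟨by rw [YoungDiagram.mem_iff_lt_rowLen]; omega,
      ⟨lam.cells.erase (i, lam.rowLen i - 1), ?_⟩, rfl⟩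
    rintro ⟨x, y⟩ ⟨u, v⟩ hle hx
    rw [Prod.mk_le_mk] at hle
    simp only [Finset.coe_erase, Set.mem_diff, Set.mem_singleton_iff, Finset.mem_coe,
      YoungDiagram.mem_cells, Prod.mk.injEq] at hx ⊢
    refine ⟨lam.up_left_mem hle.1 hle.2 hx.1, ?_⟩
    rintro ⟨rfl, rfl⟩
    apply hx.2
    have h := hx.1
    rw [YoungDiagram.mem_iff_lt_rowLen] at h
    rcases Nat.lt_or_ge u x with hu | hu
    · have := lam.rowLen_anti (u + 1) x hu
      omega
    · obtain rfl : x = u := by omega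
      omega

open Finset in
theorem jackMoment_eq (a : ℝ) (lam : YoungDiagram) (k : ℕ) :
    jackMoment a lam k = ∑ i ∈ insert 0 ((descRows lam).image Nat.succ),
      ((∏ p ∈ descRows lam, (innerContent a (i, lam.rowLen i)
          - (Real.sqrt a * lam.rowLen p - (p + 1) / Real.sqrt a))) /
        ∏ j ∈ (insert 0 ((descRows lam).image Nat.succ)).erase i,
          (innerContent a (i, lam.rowLen i) - innerContent a (j, lam.rowLen j)))
      * innerContent a (i, lam.rowLen i) ^ k := by
  have hA : {c : ℕ × ℕ | lam.IsAddableCorner c} = (fun i => (i, lam.rowLen i)) ''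
      (↑(insert 0 ((descRows lam).image Nat.succ)) : Set ℕ) := by
    ext ⟨i, j⟩
    rw [Set.mem_ofPred_eq, addable_iff, Set.mem_image]
    constructor
    · rintro ⟨rfl, h⟩; exact ⟨i, h, rfl⟩
    · rintro ⟨x, h, he⟩
      obtain ⟨rfl, rfl⟩ := Prod.mk.inj he
      exact ⟨rfl, h⟩
  have hR : {c : ℕ × ℕ | lam.IsRemovableCorner c} = (fun i => (i, lam.rowLen i - 1)) ''
      (↑(descRows lam) : Set ℕ) := by
    ext ⟨i, j⟩
    rw [Set.mem_ofPred_eq, removable_iff, Set.mem_image]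
    constructor
    · rintro ⟨rfl, h⟩; exact ⟨i, h, rfl⟩
    · rintro ⟨x, h, he⟩
      obtain ⟨rfl, rfl⟩ := Prod.mk.inj he
      exact ⟨rfl, h⟩
  have hE : ∀ i, {c : ℕ × ℕ | lam.IsAddableCorner c ∧ c ≠ (i, lam.rowLen i)} =
      (fun i => (i, lam.rowLen i)) ''
      (↑((insert 0 ((descRows lam).image Nat.succ)).erase i) : Set ℕ) := by
    intro i
    ext ⟨x, y⟩
    rw [Set.mem_ofPred_eq, addable_iff, Set.mem_image]
    simp only [Finset.mem_coe, Finset.mem_erase]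
    constructor
    · rintro ⟨⟨rfl, h⟩, hne⟩
      exact ⟨x, ⟨fun h => hne (by rw [h]), h⟩, rfl⟩
    · rintro ⟨u, ⟨hne, h⟩, he⟩
      obtain ⟨rfl, rfl⟩ := Prod.mk.inj he
      exact ⟨⟨rfl, h⟩, fun h => hne (Prod.mk.inj h).1⟩
  have inj1 : ∀ s : Set ℕ, s.InjOn (fun i => (i, lam.rowLen i)) :=
    fun s x _ y _ h => (Prod.mk.inj h).1
  have inj2 : ∀ s : Set ℕ, s.InjOn (fun i => (i, lam.rowLen i - 1)) :=
    fun s x _ y _ h => (Prod.mk.inj h).1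
  unfold jackMoment
  rw [hA, finsum_mem_image (inj1 _), finsum_mem_coe_finset]
  refine sum_congr rfl fun i _ => ?_
  rw [hE, finprod_mem_image (inj1 _), finprod_mem_coe_finset, hR, finprod_mem_image (inj2 _),
    finprod_mem_coe_finset]
  congr 2
  refine prod_congr rfl fun p hp => ?_
  rw [mem_descRows] at hp
  unfold outerContent
  have : ((lam.rowLen p - 1 : ℕ) : ℝ) + 1 = lam.rowLen p := by
    exact_mod_cast Nat.sub_add_cancel (by omega)
  simp only [this]

/-- For each `k ≥ 2` and `α > 0` there is a constant `B` (depending only on `k` and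
`α`) with `|M_k^{(α)}(λ)| ≤ B · max(λ₁, λ₁')^k` for every Young diagram `λ`. -/
theorem abs_jackMoment_le (k : ℕ) (hk : 2 ≤ k) (a : ℝ) (ha : 0 < a) :
    ∃ B : ℝ, ∀ lam : YoungDiagram,
      |jackMoment a lam k| ≤ B * (max (lam.rowLen 0) (lam.colLen 0) : ℝ) ^ k := by
  have hs : 0 < Real.sqrt a := Real.sqrt_pos.2 ha
  refine ⟨(Real.sqrt a + 1 / Real.sqrt a) ^ k, fun lam => ?_⟩
  rw [← mul_pow, jackMoment_eq]
  set Z : ℕ → ℝ := fun i => innerContent a (i, lam.rowLen i) with hZdef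
  set W : ℕ → ℝ := fun p => Real.sqrt a * lam.rowLen p - (p + 1) / Real.sqrt a with hWdef
  set T := insert 0 ((descRows lam).image Nat.succ) with hT
  have hWZ : ∀ p, W p = Z p - 1 / Real.sqrt a := fun p => by
    simp only [hZdef, hWdef, innerContent]; ring
  have hpos : 0 < 1 / Real.sqrt a := by positivity
  have h1 : ∀ p, W p ≤ Z p := fun p => by rw [hWZ]; linarith
  have h2 : ∀ p, Z (p + 1) ≤ W p := fun p => by
    simp only [hZdef, hWdef, innerContent]
    have : (lam.rowLen (p + 1) : ℝ) ≤ lam.rowLen p :=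
      by exact_mod_cast lam.rowLen_anti p (p + 1) (Nat.le_succ p)
    have := mul_le_mul_of_nonneg_left this hs.le
    push_cast
    linarith
  have hZ : StrictAnti Z := strictAnti_nat_of_succ_lt fun p => by
    have := h2 p
    rw [hWZ] at this
    linarith
  have hc : T.card = (descRows lam).card + 1 := by
    rw [hT, Finset.card_insert_of_notMem (by simp),
      Finset.card_image_of_injective _ Nat.succ_injective]
  have hsum := core_sum Z W (descRows lam) T hZ hc
  have hnn := core_nonneg Z W (descRows lam) hZ h1 h2
  set M : ℝ := max (lam.rowLen 0 : ℝ) (lam.colLen 0) with hM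
  have hb : ∀ i ∈ T, |Z i| ≤ (Real.sqrt a + 1 / Real.sqrt a) * M := by
    intro i hi
    have hi1 : (i : ℝ) ≤ M := by
      refine le_trans ?_ (le_max_right _ _)
      rw [hT, Finset.mem_insert, Finset.mem_image] at hi
      rcases hi with rfl | ⟨p, hp, rfl⟩
      · simp
      · have := Finset.mem_range.1 (Finset.mem_filter.1 hp).1
        exact_mod_cast this
    have hi2 : (lam.rowLen i : ℝ) ≤ M := by
      refine le_trans ?_ (le_max_left _ _)
      exact_mod_cast lam.rowLen_anti 0 i (Nat.zero_le i)
    have e1 := mul_le_mul_of_nonneg_left hi2 hs.le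
    have e2 := mul_le_mul_of_nonneg_left hi1 hpos.le
    have e3 : 0 ≤ Real.sqrt a * lam.rowLen i := by positivity
    have e4 : 0 ≤ 1 / Real.sqrt a * i := by positivity
    have e5 : Z i = Real.sqrt a * lam.rowLen i - 1 / Real.sqrt a * i := by
      simp only [hZdef, innerContent]; ring
    rw [e5, abs_le]
    constructor <;> linarith
  calc _ ≤ ∑ i ∈ T, |((∏ p ∈ descRows lam, (Z i - W p)) / ∏ j ∈ T.erase i, (Z i - Z j))
            * Z i ^ k| := Finset.abs_sum_le_sum_abs _ _
    _ ≤ ∑ i ∈ T, ((∏ p ∈ descRows lam, (Z i - W p)) / ∏ j ∈ T.erase i, (Z i - Z j))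
            * ((Real.sqrt a + 1 / Real.sqrt a) * M) ^ k := by
        refine Finset.sum_le_sum fun i hi => ?_
        rw [abs_mul, abs_of_nonneg (hnn i hi), abs_pow]
        exact mul_le_mul_of_nonneg_left
          (pow_le_pow_left₀ (abs_nonneg _) (hb i hi) k) (hnn i hi)
    _ = _ := by rw [← Finset.sum_mul, hsum, one_mul]
end

section
/- For every Young diagram λ, the sum of the contents j − i over all addable corners (i, j) of λ equals the sum of the contents j − i over all removable corners (i, j) of λ. (Equivalently, p₁(𝕀_λ − 𝕆_λ) = 0, where 𝕀_λ and 𝕆_λ are the multisets of contents of the inner and outer corners of λ.) -/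
theorem aux_addable (lam : YoungDiagram) (i j : ℕ) :
    lam.IsAddableCorner (i, j) ↔ j = lam.rowLen i ∧ (i = 0 ∨ lam.rowLen i < lam.rowLen (i - 1)) := by
  constructor
  · rintro ⟨h, ν, hν⟩
    have hm : ∀ a b, (a, b) ∈ ν ↔ (a = i ∧ b = j) ∨ b < lam.rowLen a := by
      intro a b
      rw [← YoungDiagram.mem_cells, hν]
      simp [YoungDiagram.mem_iff_lt_rowLen]
    rw [YoungDiagram.mem_iff_lt_rowLen] at h
    have h0 : (i, j) ∈ ν := (hm i j).2 (Or.inl ⟨rfl, rfl⟩)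
    have h1 := (hm i (j - 1)).1 (ν.up_left_mem le_rfl (Nat.sub_le _ _) h0)
    have h2 := (hm (i - 1) j).1 (ν.up_left_mem (Nat.sub_le _ _) le_rfl h0)
    have hj : j = lam.rowLen i := by omega
    refine ⟨hj, ?_⟩
    rw [← hj]
    omega
  · rintro ⟨rfl, h⟩
    refine ⟨by simp [YoungDiagram.mem_iff_lt_rowLen], ⟨insert (i, lam.rowLen i) lam.cells, ?_⟩, rfl⟩
    rintro ⟨a, b⟩ ⟨c, d⟩ ⟨hc, hd⟩ hab
    simp only [Finset.coe_insert, Set.mem_insert_iff, Finset.mem_coe, YoungDiagram.mem_cells,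
      YoungDiagram.mem_iff_lt_rowLen, Prod.mk.injEq] at hab ⊢
    simp only at hc hd
    rcases hab with ⟨rfl, rfl⟩ | hab
    · by_cases hca : c = a
      · subst hca; omega
      · have := lam.rowLen_anti c (a - 1) (by omega)
        omega
    · have := lam.rowLen_anti c a hc
      omega

theorem aux_removable (lam : YoungDiagram) (i j : ℕ) :
    lam.IsRemovableCorner (i, j) ↔ j = lam.rowLen i - 1 ∧ lam.rowLen (i + 1) < lam.rowLen i := by
  constructor
  · rintro ⟨h, ν, hν⟩
    have hm : ∀ a b, (a, b) ∈ ν ↔ ¬ (a = i ∧ b = j) ∧ b < lam.rowLen a := by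
      intro a b
      rw [← YoungDiagram.mem_cells, hν]
      simp [YoungDiagram.mem_iff_lt_rowLen]
    rw [YoungDiagram.mem_iff_lt_rowLen] at h
    have h0 : (i, j) ∉ ν := fun h => ((hm i j).1 h).1 ⟨rfl, rfl⟩
    have h1 : ¬ (i, j + 1) ∈ ν := fun h => h0 (ν.up_left_mem le_rfl (by omega) h)
    have h2 : ¬ (i + 1, j) ∈ ν := fun h => h0 (ν.up_left_mem (by omega) le_rfl h)
    rw [hm] at h1 h2
    omega
  · rintro ⟨rfl, h⟩
    refine ⟨by rw [YoungDiagram.mem_iff_lt_rowLen]; omega,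
      ⟨lam.cells.erase (i, lam.rowLen i - 1), ?_⟩, rfl⟩
    rintro ⟨a, b⟩ ⟨c, d⟩ ⟨hc, hd⟩ hab
    simp only [Finset.coe_erase, Set.mem_sdiff, Set.mem_singleton_iff, Finset.mem_coe,
      YoungDiagram.mem_cells, YoungDiagram.mem_iff_lt_rowLen, Prod.mk.injEq] at hab ⊢
    simp only at hc hd
    have h3 := lam.rowLen_anti c a hc
    refine ⟨by omega, ?_⟩
    rintro ⟨rfl, rfl⟩
    by_cases hca : c = a
    · subst hca; omega
    · have := lam.rowLen_anti (c + 1) a (by omega)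
      omega

/-- `p₁(𝕀_λ − 𝕆_λ) = 0`: the sum of the contents `j − i` over the addable corners of
a Young diagram equals the sum of the contents over its removable corners. -/
theorem sum_contents_addable_eq_sum_contents_removable (lam : YoungDiagram) :
    ∑ᶠ c ∈ {c : ℕ × ℕ | lam.IsAddableCorner c}, ((c.2 : ℤ) - (c.1 : ℤ))
      = ∑ᶠ c ∈ {c : ℕ × ℕ | lam.IsRemovableCorner c}, ((c.2 : ℤ) - (c.1 : ℤ)) := by
  classical
  obtain ⟨N, hN⟩ : ∃ N, ∀ i, N ≤ i → lam.rowLen i = 0 := by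
    refine ⟨lam.colLen 0, fun i hi => ?_⟩
    have h : ¬ (i, 0) ∈ lam := by rw [YoungDiagram.mem_iff_lt_colLen]; omega
    rw [YoungDiagram.mem_iff_lt_rowLen] at h
    omega
  have hA : {c : ℕ × ℕ | lam.IsAddableCorner c} =
      (((Finset.range (N + 1)).filter (fun i => i = 0 ∨ lam.rowLen i < lam.rowLen (i - 1))).image
        (fun i => (i, lam.rowLen i)) : Finset (ℕ × ℕ)) := by
    ext ⟨i, j⟩
    simp only [Set.mem_ofPred_eq, aux_addable, Finset.coe_image, Set.mem_image, Finset.mem_coe,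
      Finset.mem_filter, Finset.mem_range, Prod.mk.injEq]
    constructor
    · rintro ⟨rfl, h⟩
      refine ⟨i, ⟨?_, h⟩, rfl, rfl⟩
      by_contra hi
      have := hN (i - 1) (by omega)
      omega
    · rintro ⟨i, ⟨_, h⟩, rfl, rfl⟩
      exact ⟨rfl, h⟩
  have hR : {c : ℕ × ℕ | lam.IsRemovableCorner c} =
      (((Finset.range N).filter (fun i => lam.rowLen (i + 1) < lam.rowLen i)).image
        (fun i => (i, lam.rowLen i - 1)) : Finset (ℕ × ℕ)) := by
    ext ⟨i, j⟩
    simp only [Set.mem_ofPred_eq, aux_removable, Finset.coe_image, Set.mem_image, Finset.mem_coe,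
      Finset.mem_filter, Finset.mem_range, Prod.mk.injEq]
    constructor
    · rintro ⟨rfl, h⟩
      refine ⟨i, ⟨?_, h⟩, rfl, rfl⟩
      by_contra hi
      have := hN i (by omega)
      omega
    · rintro ⟨i, ⟨_, h⟩, rfl, rfl⟩
      exact ⟨rfl, h⟩
  rw [hA, hR, finsum_mem_coe_finset, finsum_mem_coe_finset,
    Finset.sum_image (fun a _ b _ h => (Prod.mk.inj h).1),
    Finset.sum_image (fun a _ b _ h => (Prod.mk.inj h).1),
    Finset.sum_filter, Finset.sum_filter, Finset.sum_range_succ', ← sub_eq_zero,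
    add_sub_right_comm, ← Finset.sum_sub_distrib]
  have key : ∀ i ∈ Finset.range N,
      ((if i + 1 = 0 ∨ lam.rowLen (i + 1) < lam.rowLen (i + 1 - 1) then ((lam.rowLen (i + 1) : ℤ) - ((i + 1 : ℕ) : ℤ)) else 0)
        - (if lam.rowLen (i + 1) < lam.rowLen i then (((lam.rowLen i - 1 : ℕ) : ℤ) - (i : ℤ)) else 0))
      = (lam.rowLen (i + 1) : ℤ) - lam.rowLen i := by
    intro i _
    have := lam.rowLen_anti i (i + 1) (by omega)
    simp only [Nat.add_sub_cancel, Nat.succ_ne_zero, false_or]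
    split_ifs <;> omega
  rw [Finset.sum_congr rfl key, Finset.sum_range_sub (fun i => (lam.rowLen i : ℤ))]
  simp [hN N le_rfl]
end

section
/- For every Young diagram λ, the number of addable corners of λ is exactly one more than the number of removable corners of λ. -/
lemma addable_iff_aux (lam : YoungDiagram) (i j : ℕ) :
    lam.IsAddableCorner (i, j) ↔ j = lam.rowLen i ∧ ∀ k, i = k + 1 → lam.rowLen i < lam.rowLen k := by
  constructor
  · rintro ⟨h, ν, hν⟩
    have hm : ∀ a b, (a, b) ∈ ν ↔ ((a = i ∧ b = j) ∨ b < lam.rowLen a) := by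
      intro a b
      rw [← YoungDiagram.mem_cells, hν, Finset.mem_insert, YoungDiagram.mem_cells,
        YoungDiagram.mem_iff_lt_rowLen, Prod.mk.injEq]
    rw [YoungDiagram.mem_iff_lt_rowLen] at h
    have hij : (i, j) ∈ ν := (hm i j).2 (Or.inl ⟨rfl, rfl⟩)
    have h1 : j = lam.rowLen i := by
      by_contra hne
      have := (hm i (lam.rowLen i)).1 (ν.up_left_mem le_rfl (by omega) hij)
      omega
    refine ⟨h1, ?_⟩
    rintro k rfl
    have := (hm k j).1 (ν.up_left_mem (by omega) le_rfl hij)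
    omega
  · rintro ⟨rfl, h⟩
    refine ⟨by simp [YoungDiagram.mem_iff_lt_rowLen], ⟨insert (i, lam.rowLen i) lam.cells, ?_⟩, rfl⟩
    rintro ⟨a, b⟩ ⟨c, d⟩ ⟨hle1, hle2⟩ hab
    simp only [Finset.mem_coe, Finset.mem_insert, YoungDiagram.mem_cells,
        YoungDiagram.mem_iff_lt_rowLen, Prod.mk.injEq] at hab hle1 hle2 ⊢
    rcases hab with ⟨rfl, rfl⟩ | hab
    · rcases Nat.lt_or_ge c a with hc | hc
      · obtain ⟨k, rfl⟩ : ∃ k, a = k + 1 := ⟨a - 1, by omega⟩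
        have := h k rfl
        have := lam.rowLen_anti c k (by omega)
        omega
      · obtain rfl : c = a := by omega
        omega
    · have := lam.rowLen_anti c a hle1
      omega

lemma removable_iff_aux (lam : YoungDiagram) (i j : ℕ) :
    lam.IsRemovableCorner (i, j) ↔ j + 1 = lam.rowLen i ∧ lam.rowLen (i + 1) < lam.rowLen i := by
  constructor
  · rintro ⟨h, ν, hν⟩
    have hm : ∀ a b, (a, b) ∈ ν ↔ (¬ (a = i ∧ b = j) ∧ b < lam.rowLen a) := by
      intro a b
      rw [← YoungDiagram.mem_cells, hν, Finset.mem_erase, YoungDiagram.mem_cells,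
        YoungDiagram.mem_iff_lt_rowLen, Ne, Prod.mk.injEq]
    rw [YoungDiagram.mem_iff_lt_rowLen] at h
    have hij : (i, j) ∉ ν := fun h' => ((hm i j).1 h').1 ⟨rfl, rfl⟩
    have h1 : ¬ j + 1 < lam.rowLen i := fun h' =>
      hij (ν.up_left_mem le_rfl (by omega) ((hm i (j + 1)).2 ⟨by omega, h'⟩))
    have h2 : ¬ j < lam.rowLen (i + 1) := fun h' =>
      hij (ν.up_left_mem (by omega) le_rfl ((hm (i + 1) j).2 ⟨by omega, h'⟩))
    omega
  · rintro ⟨h1, h2⟩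
    refine ⟨by rw [YoungDiagram.mem_iff_lt_rowLen]; omega, ⟨lam.cells.erase (i, j), ?_⟩, rfl⟩
    rintro ⟨a, b⟩ ⟨c, d⟩ ⟨hle1, hle2⟩ hab
    simp only [Finset.mem_coe, Finset.mem_erase, YoungDiagram.mem_cells, Ne,
        YoungDiagram.mem_iff_lt_rowLen, Prod.mk.injEq] at hab hle1 hle2 ⊢
    have := lam.rowLen_anti c a hle1
    refine ⟨?_, by omega⟩
    rintro ⟨rfl, rfl⟩
    rcases Nat.lt_or_ge c a with hc | hc
    · have := lam.rowLen_anti (c + 1) a (by omega)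
      omega
    · obtain rfl : c = a := by omega
      omega

/-- Every Young diagram has exactly one more addable corner than removable corners. -/
theorem card_addable_eq_card_removable_add_one (lam : YoungDiagram) :
    {c : ℕ × ℕ | lam.IsAddableCorner c}.ncard
      = {c : ℕ × ℕ | lam.IsRemovableCorner c}.ncard + 1 := by
  set S : Set ℕ := {i | lam.rowLen (i + 1) < lam.rowLen i} with hS
  have hfin : S.Finite := by
    refine (Set.finite_Iio (lam.colLen 0)).subset fun i hi => ?_
    have hi' : lam.rowLen (i + 1) < lam.rowLen i := hi
    rw [Set.mem_Iio, ← YoungDiagram.mem_iff_lt_colLen, YoungDiagram.mem_iff_lt_rowLen]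
    omega
  have hR : {c : ℕ × ℕ | lam.IsRemovableCorner c} = (fun i => (i, lam.rowLen i - 1)) '' S := by
    ext ⟨i, j⟩
    simp only [Set.mem_ofPred_eq, removable_iff_aux, Set.mem_image, hS, Prod.mk.injEq]
    constructor
    · rintro ⟨h1, h2⟩
      exact ⟨i, h2, rfl, by omega⟩
    · rintro ⟨k, hk, rfl, rfl⟩
      omega
  have hA : {c : ℕ × ℕ | lam.IsAddableCorner c}
      = insert (0, lam.rowLen 0) ((fun i => (i + 1, lam.rowLen (i + 1))) '' S) := by
    ext ⟨i, j⟩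
    simp only [Set.mem_ofPred_eq, addable_iff_aux, Set.mem_image, Set.mem_insert_iff, hS,
      Prod.mk.injEq]
    constructor
    · rintro ⟨rfl, h2⟩
      rcases i with _ | k
      · exact Or.inl ⟨rfl, rfl⟩
      · exact Or.inr ⟨k, h2 k rfl, rfl, rfl⟩
    · rintro (⟨rfl, rfl⟩ | ⟨k, hk, rfl, rfl⟩)
      · exact ⟨rfl, fun k hk => by omega⟩
      · refine ⟨rfl, fun l hl => ?_⟩
        obtain rfl : k = l := by omega
        exact hk
  rw [hR, hA, Set.ncard_insert_of_notMem _ (hfin.image _), Set.ncard_image_of_injective,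
    Set.ncard_image_of_injective]
  · intro a b h
    simpa using (Prod.mk.inj h).1
  · intro a b h
    simpa using (Prod.mk.inj h).1
  · rintro ⟨k, -, hk⟩
    simpa using (Prod.mk.inj hk).1
end

section
/- For all natural numbers k ≥ 1 and i with i ≤ k − 1, the following identity of integers holds: Σ_{j=0}^{i} (−1)^j · (k − i + j).choose (j + 1) · s(k, k − i + j) = k · s(k − 1, k − 1 − i), where s(m, t) denotes the unsigned Stirling number of the first kind, i.e. the coefficient of X^t in the rising factorial polynomial X(X+1)⋯(X+m−1) (in Lean, (ascPochhammer ℤ m).coeff t). -/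
open Polynomial in
lemma taylor_asc (n : ℕ) : taylor (-1 : ℤ) (ascPochhammer ℤ (n + 1))
    = ascPochhammer ℤ (n + 1) - C ((n : ℤ) + 1) * ascPochhammer ℤ n := by
  have h : taylor (-1 : ℤ) (ascPochhammer ℤ (n + 1)) = (X - 1) * ascPochhammer ℤ n := by
    rw [ascPochhammer_succ_left, taylor_apply, mul_comp, comp_assoc]
    simp [sub_eq_add_neg]
  rw [h, ascPochhammer_succ_right]
  simp
  ring

/-- Goulden's Stirling-number identity used to compute the linear terms of Kerov
polynomials for Jack characters:
`Σ_{j=0}^{i} (−1)^j · C(k−i+j, j+1) · s(k, k−i+j) = k · s(k−1, k−1−i)`,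
where `s(m, t) = (ascPochhammer ℤ m).coeff t` is the unsigned Stirling number of the
first kind. -/
theorem stirling_identity (k i : ℕ) (hk : 1 ≤ k) (hi : i ≤ k - 1) :
    ∑ j ∈ Finset.range (i + 1),
        (-1 : ℤ) ^ j * ((k - i + j).choose (j + 1) : ℤ)
          * (ascPochhammer ℤ k).coeff (k - i + j)
      = (k : ℤ) * (ascPochhammer ℤ (k - 1)).coeff (k - 1 - i) := by
  obtain ⟨n, rfl⟩ : ∃ n, k = n + 1 := ⟨k - 1, by omega⟩
  obtain ⟨m, rfl⟩ : ∃ m, n = m + i := ⟨n - i, by omega⟩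
  have h := congrArg (fun p => Polynomial.coeff p m) (taylor_asc (m + i))
  have hd : (Polynomial.hasseDeriv m (ascPochhammer ℤ (m + i + 1))).natDegree < i + 1 + 1 := by
    have := Polynomial.natDegree_hasseDeriv_le (ascPochhammer ℤ (m + i + 1)) m
    rw [ascPochhammer_natDegree] at this
    omega
  simp only [Polynomial.taylor_coeff, Polynomial.coeff_sub, Polynomial.coeff_C_mul] at h
  rw [Polynomial.eval_eq_sum_range' hd, Finset.sum_range_succ'] at h
  simp only [Polynomial.hasseDeriv_coeff, zero_add, Nat.choose_self, Nat.cast_one, one_mul,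
    pow_zero, mul_one] at h
  have e1 : m + i + 1 - 1 - i = m := by omega
  have e2 : m + i + 1 - 1 = m + i := by omega
  rw [e1, e2]
  have hs : ∑ j ∈ Finset.range (i + 1),
        (-1 : ℤ) ^ j * ((m + i + 1 - i + j).choose (j + 1) : ℤ)
          * (ascPochhammer ℤ (m + i + 1)).coeff (m + i + 1 - i + j)
      = - ∑ j ∈ Finset.range (i + 1), ((j + 1 + m).choose m : ℤ)
          * (ascPochhammer ℤ (m + i + 1)).coeff (j + 1 + m) * (-1) ^ (j + 1) := by
    rw [← Finset.sum_neg_distrib]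
    refine Finset.sum_congr rfl fun j _ => ?_
    have e3 : m + i + 1 - i + j = j + 1 + m := by omega
    rw [e3, Nat.choose_symm_add]
    ring
  rw [hs]
  push_cast at h ⊢
  linarith
end
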